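/- arXiv:1603.08205 — 3 statements merged into one kernel-verified Lean document; each statement's English description precedes it below -/
import Mathlib

section
/- Let t* > 0 and let z₊, z₋ : [0,t*]×ℝ³ → ℝ³ be continuous vector fields with |z±(t,x)| ≤ 1/2 for all (t,x); set Z± = z± ± e₃ where e₃ = (0,0,1). Suppose ψ± : [0,t*]×ℝ³ → ℝ³ satisfy ∂_t ψ±(t,y) = Z±(t, ψ±(t,y)) and ψ±(0,y) = y, and that for each t the maps ψ±(t,·) are bijections of ℝ³. Define u±(t,x) ∈ ℝ by the relation u±(t, ψ±(t,y)) = y₃ for all y ∈ ℝ³. Then for all (t,x) ∈ [0,t*]×ℝ³, |(u₋(t,x) − u₊(t,x)) − 2t| ≤ t; in particular t ≤ |u₊(t,x) − u₋(t,x)| ≤ 3t. -/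
open Set

noncomputable section

abbrev E3 : Type := EuclideanSpace ℝ (Fin 3)

/-- The third standard basis vector e₃ = (0,0,1). -/
def e3 : E3 := EuclideanSpace.single 2 1

/-- A curve whose velocity stays within `C` of a constant vector `c` drifts from the
uniform motion with velocity `c` by at most `C * t`, in every coordinate. -/
theorem abs_coord_sub_drift_le {f w : ℝ → E3} {c : E3} {C t : ℝ} (ht : 0 ≤ t)
    (hf : ∀ s ∈ Icc (0 : ℝ) t, HasDerivAt f (w s + c) s)
    (hw : ∀ s, ‖w s‖ ≤ C) (i : Fin 3) :
    |f t i - f 0 i - t * c i| ≤ C * t := by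
  have hderiv : ∀ s ∈ Icc (0 : ℝ) t,
      HasDerivWithinAt (fun s => f s - s • c) (w s) (Icc 0 t) s := fun s hs => by
    have h := ((hf s hs).sub ((hasDerivAt_id s).smul_const c)).hasDerivWithinAt (s := Icc 0 t)
    rw [one_smul, add_sub_cancel_right] at h
    exact h
  have hnorm := norm_image_sub_le_of_norm_deriv_le_segment' hderiv (fun s _ => hw s) t
    (right_mem_Icc.2 ht)
  have hcoord := (PiLp.norm_apply_le (f t - t • c - (f 0 - (0 : ℝ) • c)) i).trans hnorm
  simp only [PiLp.sub_apply, PiLp.smul_apply, smul_eq_mul, Real.norm_eq_abs, zero_mul,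
    sub_zero] at hcoord
  rwa [sub_right_comm]

/-- **Separation of the optical functions (Lemma 2.3).**
Let `z±` be continuous with `|z±| ≤ 1/2` and `Z± = z± ± e₃`. If `ψ±` are the flows of
`Z±` starting from the identity, each `ψ±(t,·)` being a bijection of ℝ³, and the
optical functions `u±` satisfy `u±(t, ψ±(t,y)) = y₃`, then
`|(u₋ − u₊) − 2t| ≤ t`, and in particular `t ≤ |u₊ − u₋| ≤ 3t`. -/
theorem optical_function_separation
    (tstar : ℝ) (htstar : 0 < tstar)
    (zp zm : ℝ → E3 → E3)
    (hcp : Continuous fun q : ℝ × E3 => zp q.1 q.2)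
    (hcm : Continuous fun q : ℝ × E3 => zm q.1 q.2)
    (hbp : ∀ t : ℝ, ∀ x : E3, ‖zp t x‖ ≤ 1 / 2)
    (hbm : ∀ t : ℝ, ∀ x : E3, ‖zm t x‖ ≤ 1 / 2)
    (ψp ψm : ℝ → E3 → E3)
    (hψp0 : ∀ y, ψp 0 y = y) (hψm0 : ∀ y, ψm 0 y = y)
    (hψp : ∀ t ∈ Icc (0 : ℝ) tstar, ∀ y : E3,
      HasDerivAt (fun s => ψp s y) (zp t (ψp t y) + e3) t)
    (hψm : ∀ t ∈ Icc (0 : ℝ) tstar, ∀ y : E3,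
      HasDerivAt (fun s => ψm s y) (zm t (ψm t y) - e3) t)
    (hbijp : ∀ t ∈ Icc (0 : ℝ) tstar, Function.Bijective (ψp t))
    (hbijm : ∀ t ∈ Icc (0 : ℝ) tstar, Function.Bijective (ψm t))
    (up um : ℝ → E3 → ℝ)
    (hup : ∀ t ∈ Icc (0 : ℝ) tstar, ∀ y : E3, up t (ψp t y) = y 2)
    (hum : ∀ t ∈ Icc (0 : ℝ) tstar, ∀ y : E3, um t (ψm t y) = y 2) :
    ∀ t ∈ Icc (0 : ℝ) tstar, ∀ x : E3,
      |(um t x - up t x) - 2 * t| ≤ t ∧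
      t ≤ |up t x - um t x| ∧ |up t x - um t x| ≤ 3 * t := by
  intro t ht x
  obtain ⟨y, hy⟩ := (hbijp t ht).2 x
  obtain ⟨y', hy'⟩ := (hbijm t ht).2 x
  have hsub : Icc (0 : ℝ) t ⊆ Icc 0 tstar := Icc_subset_Icc_right ht.2
  have hp := abs_coord_sub_drift_le (w := fun s => zp s (ψp s y)) (c := e3) ht.1
    (fun s hs => hψp s (hsub hs) y) (fun s => hbp _ _) 2
  have hm := abs_coord_sub_drift_le (w := fun s => zm s (ψm s y')) (c := -e3) ht.1
    (fun s hs => by simpa only [sub_eq_add_neg] using hψm s (hsub hs) y')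
    (fun s => hbm _ _) 2
  have he : e3 2 = 1 := by simp [e3]
  have hu : up t x = y 2 := hy ▸ hup t ht y
  have hu' : um t x = y' 2 := hy' ▸ hum t ht y'
  simp only [hy, hψp0, he] at hp
  simp only [hy', hψm0, PiLp.neg_apply, he] at hm
  rw [abs_le] at hp hm
  have ht0 := ht.1
  have hle : up t x - um t x ≤ 0 := by linarith
  rw [abs_of_nonpos hle, abs_le]
  refine ⟨⟨?_, ?_⟩, ?_, ?_⟩ <;> linarith

end
end

section
/- Let R ≥ 10, t ≥ 0 and let a, b ∈ ℝ satisfy |a| + |b| ≥ t. Then (R² + a²)^{1/2} (R² + b²)^{1/2} ≥ (R/2)(R² + t²)^{1/2}, and log((R² + a²)^{1/2}) · log((R² + b²)^{1/2}) ≥ (log R / 2) · log((R² + t²)^{1/2}). -/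
/-- **Separation of the weights (estimate (2.9)).**
For `R ≥ 10`, `t ≥ 0` and reals `a, b` with `|a| + |b| ≥ t`:
`(R²+a²)^{1/2}(R²+b²)^{1/2} ≥ (R/2)(R²+t²)^{1/2}` and
`log((R²+a²)^{1/2}) log((R²+b²)^{1/2}) ≥ (log R/2) log((R²+t²)^{1/2})`. -/
theorem weight_separation
    (R t a b : ℝ) (hR : 10 ≤ R) (ht : 0 ≤ t) (hab : t ≤ |a| + |b|) :
    R / 2 * Real.sqrt (R ^ 2 + t ^ 2)
        ≤ Real.sqrt (R ^ 2 + a ^ 2) * Real.sqrt (R ^ 2 + b ^ 2) ∧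
    Real.log R / 2 * Real.log (Real.sqrt (R ^ 2 + t ^ 2))
        ≤ Real.log (Real.sqrt (R ^ 2 + a ^ 2)) * Real.log (Real.sqrt (R ^ 2 + b ^ 2)) := by
  have ht2 : t ^ 2 ≤ 2 * (a ^ 2 + b ^ 2) := by
    nlinarith [sq_abs a, sq_abs b, sq_nonneg (|a| - |b|), pow_le_pow_left₀ ht hab 2]
  have hR0 : 0 < R := by linarith
  have le_weight (x : ℝ) : R ≤ Real.sqrt (R ^ 2 + x ^ 2) :=
    Real.le_sqrt_of_sq_le (by nlinarith [sq_nonneg x])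
  have key : R / 2 * Real.sqrt (R ^ 2 + t ^ 2)
      ≤ Real.sqrt (R ^ 2 + a ^ 2) * Real.sqrt (R ^ 2 + b ^ 2) := by
    rw [← Real.sqrt_mul (by positivity)]
    apply Real.le_sqrt_of_sq_le
    rw [mul_pow, Real.sq_sqrt (by positivity)]
    nlinarith [mul_le_mul_of_nonneg_left ht2 (sq_nonneg R), sq_nonneg (a * b),
      sq_nonneg (R * a), sq_nonneg (R * b), sq_nonneg (R ^ 2)]
  refine ⟨key, ?_⟩
  have hA := le_weight a
  have hB := le_weight b
  have hT := le_weight t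
  set A := Real.sqrt (R ^ 2 + a ^ 2)
  set B := Real.sqrt (R ^ 2 + b ^ 2)
  set T := Real.sqrt (R ^ 2 + t ^ 2)
  have hA0 : 0 < A := hR0.trans_le hA
  have hB0 : 0 < B := hR0.trans_le hB
  have hT0 : 0 < T := hR0.trans_le hT
  have hlog := Real.log_le_log (by positivity) key
  rw [Real.log_mul (by positivity) hT0.ne', Real.log_div hR0.ne' two_ne_zero,
    Real.log_mul hA0.ne' hB0.ne'] at hlog
  have hlogR : 0 < Real.log R := Real.log_pos (by linarith)
  have hlogA := Real.log_le_log hR0 hA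
  have hlogB := Real.log_le_log hR0 hB
  have hlogT : 2 * Real.log 2 ≤ Real.log T := by
    have h := Real.log_le_log (by norm_num) (show (2 : ℝ) ^ 2 ≤ T by linarith)
    rwa [Real.log_pow, Nat.cast_ofNat] at h
  have hsum : Real.log R + Real.log T / 2 ≤ Real.log A + Real.log B := by linarith
  nlinarith [mul_nonneg (sub_nonneg.2 hlogA) (sub_nonneg.2 hlogB),
    mul_le_mul_of_nonneg_left hsum hlogR.le]
end

section
/- There is a universal constant C > 0 with the following property. Let ω > 1, ε > 0 and t ≥ 0, and let z₊, z₋ : ℝ³ → ℝ³ be C¹ divergence-free vector fields satisfying |z±(y)| ≤ ε (1 + |y₃ ± t|)^{-ω} and |∇z±(y)| ≤ ε (1 + |y₃ ± t|)^{-ω} for all y ∈ ℝ³. Let F(y) = Σ_{i,j} ∂_i z₋^j(y) ∂_j z₊^i(y), and define the Newtonian potential gradient (∇p)(x) = −(1/4π) ∫_{ℝ³} ∇_x(1/|x − y|) F(y) dy. Then |(∇p)(x)| ≤ C ε² (1 + t)^{-ω} for all x ∈ ℝ³. -/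
open MeasureTheory Set

noncomputable section

/-- The standard basis vectors of ℝ³. -/
def e3b (i : Fin 3) : E3 := EuclideanSpace.single i 1

/-- The i-th partial derivative of a scalar function. -/
def pd (i : Fin 3) (g : E3 → ℝ) (x : E3) : ℝ := fderiv ℝ g x (e3b i)

/-- Spatial divergence of a vector field. -/
def divg (f : E3 → E3) (x : E3) : ℝ := ∑ i : Fin 3, (fderiv ℝ f x (e3b i)) i

/-- `|∇f|²`: the sum of squares of all first order partial derivatives of all
components of `f`. -/
def sqDeriv1 (f : E3 → E3) (x : E3) : ℝ :=
  ∑ α : Fin 1 → Fin 3, ‖iteratedFDeriv ℝ 1 f x (fun i => e3b (α i))‖ ^ 2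

/-- The quadratic interaction term `F = Σ_{i,j} ∂ᵢz₋ʲ ∂ⱼz₊ⁱ`. -/
def pressF (zp zm : E3 → E3) (y : E3) : ℝ :=
  ∑ i : Fin 3, ∑ j : Fin 3, pd i (fun z => zm z j) y * pd j (fun z => zp z i) y

/-- The Newtonian potential gradient
`(∇p)(x) = −(1/4π) ∫ ∇ₓ(1/|x−y|) F(y) dy = (1/4π) ∫ (F(y)/|x−y|³) (x−y) dy`. -/
def gradP (zp zm : E3 → E3) (x : E3) : E3 :=
  (1 / (4 * Real.pi)) • ∫ y, (pressF zp zm y / ‖x - y‖ ^ 3) • (x - y)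

lemma continuous_pd (i : Fin 3) {f : E3 → ℝ} (hf : ContDiff ℝ 1 f) :
    Continuous fun y => pd i f y :=
  (hf.continuous_fderiv one_ne_zero).clm_apply continuous_const

lemma integral_mul_pd_eq_neg (i : Fin 3) {f g : E3 → ℝ} (hf : ContDiff ℝ 1 f)
    (hg : ContDiff ℝ 1 g) (hc : HasCompactSupport f) :
    ∫ y, f y * pd i g y = -∫ y, pd i f y * g y := by
  have hf' := continuous_pd i hf
  have hg' := continuous_pd i hg
  have hc' : HasCompactSupport fun y => pd i f y := hc.fderiv_apply ℝ (e3b i)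
  exact integral_mul_fderiv_eq_neg_fderiv_mul_of_integrable
    ((hf'.mul hg.continuous).integrable_of_hasCompactSupport hc'.mul_right)
    ((hf.continuous.mul hg').integrable_of_hasCompactSupport hc.mul_right)
    ((hf.continuous.mul hg.continuous).integrable_of_hasCompactSupport hc.mul_right)
    (fun x _ => hf.differentiable one_ne_zero x) (fun x _ => hg.differentiable one_ne_zero x)

lemma contDiff_pd (i : Fin 3) {f : E3 → ℝ} (hf : ContDiff ℝ 2 f) :
    ContDiff ℝ 1 fun y => pd i f y :=
  (hf.fderiv_right (m := 1) (by norm_num)).clm_apply contDiff_const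

lemma hasCompactSupport_pd (i : Fin 3) {f : E3 → ℝ} (hf : HasCompactSupport f) :
    HasCompactSupport fun y => pd i f y :=
  hf.fderiv_apply ℝ (e3b i)

lemma pd_mul (i : Fin 3) {f g : E3 → ℝ} (hf : Differentiable ℝ f) (hg : Differentiable ℝ g)
    (y : E3) : pd i (fun z => f z * g z) y = pd i f y * g y + f y * pd i g y := by
  simp only [pd]
  rw [fderiv_fun_mul (hf y) (hg y)]
  simp [mul_comm, add_comm]

lemma ContDiff.e3_apply {n : WithTop ℕ∞} {f : E3 → E3} (hf : ContDiff ℝ n f) (i : Fin 3) :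
    ContDiff ℝ n fun y => f y i :=
  (EuclideanSpace.proj (𝕜 := ℝ) i).contDiff.comp hf

lemma pd_apply (i j : Fin 3) {f : E3 → E3} (hf : ContDiff ℝ 1 f) (y : E3) :
    pd i (fun z => f z j) y = fderiv ℝ f y (e3b i) j := by
  have h := ((EuclideanSpace.proj (𝕜 := ℝ) j).hasFDerivAt.comp y
    (hf.differentiable one_ne_zero y).hasFDerivAt).fderiv
  have h2 : (fun z => f z j) = (EuclideanSpace.proj (𝕜 := ℝ) j : E3 → ℝ) ∘ f := rfl
  rw [pd, h2, h]
  rfl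

lemma sum_pd_eq_zero {f : E3 → E3} (hf : ContDiff ℝ 1 f) (hd : ∀ x, divg f x = 0) (y : E3) :
    ∑ i, pd i (fun z => f z i) y = 0 := by
  rw [← hd y, divg]
  exact Finset.sum_congr rfl fun i _ => pd_apply i i hf y

lemma abs_pd_le {f : E3 → E3} (hf : ContDiff ℝ 1 f) (i j : Fin 3) (y : E3) :
    |pd i (fun z => f z j) y| ≤ √(sqDeriv1 f y) := by
  rw [pd_apply i j hf]
  refine (PiLp.norm_apply_le (fderiv ℝ f y (e3b i)) j).trans (Real.le_sqrt_of_sq_le ?_)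
  have := Finset.single_le_sum (s := Finset.univ)
    (f := fun α : Fin 1 → Fin 3 => ‖iteratedFDeriv ℝ 1 f y (fun k => e3b (α k))‖ ^ 2)
    (fun _ _ => sq_nonneg _) (Finset.mem_univ (fun _ => i))
  simpa only [sqDeriv1, iteratedFDeriv_one_apply] using this

lemma pd_comp_smul_sub (i : Fin 3) {f : E3 → ℝ} (hf : Differentiable ℝ f) (l : ℝ) (x y : E3) :
    pd i (fun z => f (l • (z - x))) y = l * pd i f (l • (y - x)) := by
  have h1 : HasFDerivAt (fun z : E3 => l • (z - x)) (l • ContinuousLinearMap.id ℝ E3) y :=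
    ((hasFDerivAt_id y).sub_const x).const_smul l
  have h := ((hf (l • (y - x))).hasFDerivAt.comp y h1).fderiv
  have h2 : (fun z => f (l • (z - x))) = f ∘ (fun z : E3 => l • (z - x)) := rfl
  rw [pd, h2, h]
  simp [pd]

lemma tendsto_diffQuot (j : Fin 3) {f : E3 → ℝ} (hf : Differentiable ℝ f) (y : E3) :
    Filter.Tendsto (fun n : ℕ => ((n : ℝ) + 1) * (f (y + ((n : ℝ) + 1)⁻¹ • e3b j) - f y))
      Filter.atTop (nhds (pd j f y)) := by
  have h := ((hf y).hasFDerivAt.hasLineDerivAt (e3b j)).tendsto_slope_zero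
  have h2 : Filter.Tendsto (fun n : ℕ => ((n : ℝ) + 1)⁻¹) Filter.atTop (nhdsWithin 0 {0}ᶜ) := by
    refine tendsto_nhdsWithin_iff.2 ⟨?_, Filter.Eventually.of_forall fun n => ?_⟩
    · simpa [one_div] using tendsto_one_div_add_atTop_nhds_zero_nat (𝕜 := ℝ)
    · simp; positivity
  have h3 := h.comp h2
  simpa [Function.comp_def, pd] using h3

lemma pd_diffQuot (i : Fin 3) {f : E3 → ℝ} (hf : Differentiable ℝ f) (c : ℝ) (v y : E3) :
    pd i (fun z => c * (f (z + v) - f z)) y = c * (pd i f (y + v) - pd i f y) := by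
  have h1 : HasFDerivAt (fun z => f (z + v)) (fderiv ℝ f (y + v)) y := by
    exact (hf (y + v)).hasFDerivAt.comp y ((hasFDerivAt_id y).add_const v)
  have h := ((h1.sub (hf y).hasFDerivAt).const_mul c).fderiv
  rw [pd, show (fun z => c * (f (z + v) - f z)) =
    fun z => c * ((fun z => f (z + v)) - f) z from rfl, h]
  simp [pd]

lemma abs_diffQuot_le {f : E3 → ℝ} (hf : Differentiable ℝ f) {c : ℝ} (hc : 0 < c)
    (j : Fin 3) {D : ℝ} (hD : ∀ y, |pd j f y| ≤ D) (y : E3) :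
    |c * (f (y + c⁻¹ • e3b j) - f y)| ≤ D := by
  have hder : ∀ s : ℝ, HasDerivAt (fun s : ℝ => f (y + s • e3b j)) (pd j f (y + s • e3b j)) s := by
    intro s
    have h1 : HasDerivAt (fun s : ℝ => y + s • e3b j) (e3b j) s := by
      simpa using ((hasDerivAt_id s).smul_const (e3b j)).const_add y
    exact (hf (y + s • e3b j)).hasFDerivAt.comp_hasDerivAt s h1
  have := Convex.norm_image_sub_le_of_norm_hasDerivWithin_le (s := univ)
    (fun s _ => (hder s).hasDerivWithinAt) (fun s _ => hD _) convex_univ (mem_univ 0) (mem_univ c⁻¹)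
  simp only [Real.norm_eq_abs, zero_smul, add_zero, sub_zero, abs_of_pos (inv_pos.2 hc)] at this
  rw [abs_mul, abs_of_pos hc]
  calc c * _ ≤ c * (D * c⁻¹) := by gcongr
    _ = D := by field_simp

lemma sum_integral_mul_diffQuot {f : E3 → ℝ} {u w : E3 → E3} (hf : ContDiff ℝ 1 f)
    (hc : HasCompactSupport f) (hu : ContDiff ℝ 1 u) (hw : ContDiff ℝ 1 w)
    (hdw : ∀ x, divg w x = 0) (j : Fin 3) (c : ℝ) (v : E3) :
    ∑ i, ∫ y, (f y * pd i (fun z => u z j) y) * (c * (w (y + v) i - w y i)) =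
      -∑ i, ∫ y, (pd i f y * u y j) * (c * (w (y + v) i - w y i)) := by
  have hq (i : Fin 3) : ContDiff ℝ 1 fun y => c * (w (y + v) i - w y i) :=
    contDiff_const.mul (((hw.e3_apply i).comp (contDiff_id.add contDiff_const)).sub (hw.e3_apply i))
  have huj := hu.e3_apply j
  have hcq (i : Fin 3) := continuous_pd i (hq i)
  have key (i : Fin 3) :
      ∫ y, (f y * pd i (fun z => u z j) y) * (c * (w (y + v) i - w y i)) =
        -(∫ y, (pd i f y * u y j) * (c * (w (y + v) i - w y i)))
        - ∫ y, (f y * u y j) * pd i (fun y => c * (w (y + v) i - w y i)) y := by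
    have h := integral_mul_pd_eq_neg i (hf.mul (hq i)) huj hc.mul_right
    rw [← neg_add', ← integral_add]
    · refine (integral_congr_ae (Filter.Eventually.of_forall fun y => mul_right_comm _ _ _)).trans
        (h.trans (congrArg _ (integral_congr_ae (Filter.Eventually.of_forall fun y => ?_))))
      simp only []
      rw [pd_mul i (hf.differentiable one_ne_zero) ((hq i).differentiable one_ne_zero)]
      ring
    · exact (((continuous_pd i hf).mul huj.continuous).mul
        (hq i).continuous).integrable_of_hasCompactSupport
        (hasCompactSupport_pd i hc).mul_right.mul_right
    · exact ((hf.continuous.mul huj.continuous).mul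
        (hcq i)).integrable_of_hasCompactSupport hc.mul_right.mul_right
  rw [Finset.sum_congr rfl fun i _ => key i, Finset.sum_sub_distrib, Finset.sum_neg_distrib,
    sub_eq_self, ← integral_finsetSum]
  · have h0 (y : E3) : ∑ i, (f y * u y j) * pd i (fun y => c * (w (y + v) i - w y i)) y = 0 := by
      rw [← Finset.mul_sum]
      simp_rw [fun i => pd_diffQuot i ((hw.e3_apply i).differentiable one_ne_zero) c v y]
      rw [← Finset.mul_sum, Finset.sum_sub_distrib, sum_pd_eq_zero hw hdw, sum_pd_eq_zero hw hdw]
      simp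
    simp [h0]
  · exact fun i _ => ((hf.continuous.mul huj.continuous).mul
      (hcq i)).integrable_of_hasCompactSupport hc.mul_right.mul_right

lemma tendsto_integral_mul_diffQuot {g h : E3 → ℝ} (hg : Continuous g) (hc : HasCompactSupport g)
    (hh : ContDiff ℝ 1 h) (j : Fin 3) {D : ℝ} (hD : ∀ y, |pd j h y| ≤ D) :
    Filter.Tendsto (fun n : ℕ =>
      ∫ y, g y * (((n : ℝ) + 1) * (h (y + ((n : ℝ) + 1)⁻¹ • e3b j) - h y)))
      Filter.atTop (nhds (∫ y, g y * pd j h y)) := by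
  have hdiff := hh.differentiable one_ne_zero
  refine tendsto_integral_of_dominated_convergence (fun y => |g y| * D) (fun n => ?_)
    ((hg.integrable_of_hasCompactSupport hc).abs.mul_const D) (fun n => ?_) ?_
  · have := hh.continuous
    exact Continuous.aestronglyMeasurable (by fun_prop)
  · refine Filter.Eventually.of_forall fun y => ?_
    rw [norm_mul]
    exact mul_le_mul_of_nonneg_left (abs_diffQuot_le hdiff (by positivity) j hD y) (norm_nonneg _)
  · exact Filter.Eventually.of_forall fun y => (tendsto_diffQuot j hdiff y).const_mul _

lemma integral_mul_pressF {f : E3 → ℝ} {w u : E3 → E3} (hf : ContDiff ℝ 2 f)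
    (hc : HasCompactSupport f) (hw : ContDiff ℝ 1 w) (hu : ContDiff ℝ 1 u)
    (hdw : ∀ x, divg w x = 0) (hdu : ∀ x, divg u x = 0) {D : ℝ}
    (hD : ∀ i j y, |pd j (fun z => w z i) y| ≤ D) :
    ∫ y, f y * pressF w u y =
      ∑ i, ∑ j, ∫ y, pd j (fun z => pd i f z) y * (u y j * w y i) := by
  have hf1 : ContDiff ℝ 1 f := hf.of_le (by norm_num)
  have hpf (i : Fin 3) := contDiff_pd i hf
  have hcp (i : Fin 3) := hasCompactSupport_pd i hc
  have hint (i j : Fin 3) : Integrable fun y =>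
      (f y * pd i (fun z => u z j) y) * pd j (fun z => w z i) y :=
    ((hf.continuous.mul (continuous_pd i (hu.e3_apply j))).mul
      (continuous_pd j (hw.e3_apply i))).integrable_of_hasCompactSupport hc.mul_right.mul_right
  have step1 (j : Fin 3) :
      ∑ i, ∫ y, (f y * pd i (fun z => u z j) y) * pd j (fun z => w z i) y =
        -∑ i, ∫ y, (pd i f y * u y j) * pd j (fun z => w z i) y := by
    refine tendsto_nhds_unique (tendsto_finsetSum _ fun i _ =>
      tendsto_integral_mul_diffQuot (hf.continuous.mul (continuous_pd i (hu.e3_apply j)))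
        hc.mul_right (hw.e3_apply i) j (hD i j)) ?_
    refine Filter.Tendsto.congr
      (fun n => (sum_integral_mul_diffQuot hf1 hc hu hw hdw j _ _).symm) ?_
    exact (tendsto_finsetSum _ fun i _ =>
      tendsto_integral_mul_diffQuot ((hpf i).continuous.mul (hu.e3_apply j).continuous)
        (hcp i).mul_right (hw.e3_apply i) j (hD i j)).neg
  have step2 (i : Fin 3) :
      -∑ j, ∫ y, (pd i f y * u y j) * pd j (fun z => w z i) y =
        ∑ j, ∫ y, pd j (fun z => pd i f z) y * (u y j * w y i) := by
    have key (j : Fin 3) : -∫ y, (pd i f y * u y j) * pd j (fun z => w z i) y =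
        (∫ y, pd j (fun z => pd i f z) y * (u y j * w y i)) +
          ∫ y, (pd i f y * w y i) * pd j (fun z => u z j) y := by
      rw [integral_mul_pd_eq_neg j ((hpf i).mul (hu.e3_apply j)) (hw.e3_apply i)
        (hcp i).mul_right, neg_neg, ← integral_add]
      · congr 1; ext y
        rw [pd_mul j ((hpf i).differentiable one_ne_zero)
          ((hu.e3_apply j).differentiable one_ne_zero)]
        ring
      · exact ((continuous_pd j (hpf i)).mul ((hu.e3_apply j).continuous.mul
          (hw.e3_apply i).continuous)).integrable_of_hasCompactSupport
          (hasCompactSupport_pd j (hcp i)).mul_right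
      · exact (((hpf i).continuous.mul (hw.e3_apply i).continuous).mul
          (continuous_pd j (hu.e3_apply j))).integrable_of_hasCompactSupport
          (hcp i).mul_right.mul_right
    rw [← Finset.sum_neg_distrib, Finset.sum_congr rfl fun j _ => key j, Finset.sum_add_distrib,
      add_eq_left, ← integral_finsetSum]
    · have h0 (y : E3) : ∑ j, (pd i f y * w y i) * pd j (fun z => u z j) y = 0 := by
        rw [← Finset.mul_sum, sum_pd_eq_zero hu hdu, mul_zero]
      simp [h0]
    · exact fun j _ => (((hpf i).continuous.mul (hw.e3_apply i).continuous).mul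
        (continuous_pd j (hu.e3_apply j))).integrable_of_hasCompactSupport
        (hcp i).mul_right.mul_right
  have hexp (y : E3) : f y * pressF w u y =
      ∑ i, ∑ j, (f y * pd i (fun z => u z j) y) * pd j (fun z => w z i) y := by
    simp only [pressF, Finset.mul_sum, mul_assoc]
  simp_rw [hexp]
  rw [integral_finsetSum _ fun i _ => integrable_finsetSum _ fun j _ => hint i j]
  simp_rw [integral_finsetSum _ fun j _ => hint _ j]
  rw [Finset.sum_comm]
  simp_rw [step1]
  rw [Finset.sum_neg_distrib, Finset.sum_comm, ← Finset.sum_neg_distrib]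
  exact Finset.sum_congr rfl fun i _ => step2 i

/-- The `L¹` norm of the Hessian. -/
def hessMass (f : E3 → ℝ) : ℝ := ∑ i, ∑ j, ∫ y, |pd j (fun z => pd i f z) y|

lemma hessMass_nonneg (f : E3 → ℝ) : 0 ≤ hessMass f :=
  Finset.sum_nonneg fun _ _ => Finset.sum_nonneg fun _ _ => integral_nonneg fun _ => abs_nonneg _

lemma hessMass_comp_smul_sub {f : E3 → ℝ} (hf : ContDiff ℝ 2 f) {l : ℝ} (hl : 0 < l) (x : E3) :
    hessMass (fun y => f (l • (y - x))) = l⁻¹ * hessMass f := by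
  simp only [hessMass, Finset.mul_sum]
  refine Finset.sum_congr rfl fun i _ => Finset.sum_congr rfl fun j _ => ?_
  have h1 (y : E3) : pd j (fun z => pd i (fun y => f (l • (y - x))) z) y =
      l * (l * pd j (fun z => pd i f z) (l • (y - x))) := by
    have : (fun z => pd i (fun y => f (l • (y - x))) z) =
        fun z => (fun y => l * pd i f y) (l • (z - x)) := by
      ext z; exact pd_comp_smul_sub i (hf.differentiable two_ne_zero) l x z
    have hd := (contDiff_pd i hf).differentiable one_ne_zero
    rw [this, pd_comp_smul_sub j (hd.const_mul l) l x y]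
    congr 1
    simp only [pd] at hd ⊢
    rw [fderiv_const_mul (hd _)]
    rfl
  simp_rw [h1, abs_mul, abs_of_pos hl]
  rw [integral_const_mul, integral_const_mul,
    integral_sub_right_eq_self (fun y => |pd j (fun z => pd i f z) (l • y)|) x,
    Measure.integral_comp_smul volume (fun y => |pd j (fun z => pd i f z) y|) l]
  simp only [finrank_euclideanSpace, Fintype.card_fin, smul_eq_mul,
    abs_of_pos (inv_pos.2 (pow_pos hl 3))]
  field_simp

lemma abs_integral_mul_pressF_le {f : E3 → ℝ} {w u : E3 → E3} (hf : ContDiff ℝ 2 f)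
    (hc : HasCompactSupport f) (hw : ContDiff ℝ 1 w) (hu : ContDiff ℝ 1 u)
    (hdw : ∀ x, divg w x = 0) (hdu : ∀ x, divg u x = 0) {D A : ℝ}
    (hD : ∀ i j y, |pd j (fun z => w z i) y| ≤ D) (hA : ∀ i j y, |u y j * w y i| ≤ A) :
    |∫ y, f y * pressF w u y| ≤ hessMass f * A := by
  rw [integral_mul_pressF hf hc hw hu hdw hdu hD, hessMass, Finset.sum_mul]
  refine (Finset.abs_sum_le_sum_abs _ _).trans (Finset.sum_le_sum fun i _ => ?_)
  rw [Finset.sum_mul]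
  refine (Finset.abs_sum_le_sum_abs _ _).trans (Finset.sum_le_sum fun j _ => ?_)
  rw [← integral_mul_const]
  have hint : Integrable fun y => pd j (fun z => pd i f z) y :=
    (continuous_pd j (contDiff_pd i hf)).integrable_of_hasCompactSupport
      (hasCompactSupport_pd j (hasCompactSupport_pd i hc))
  rw [← Real.norm_eq_abs]
  refine norm_integral_le_of_norm_le (hint.abs.mul_const A)
    (Filter.Eventually.of_forall fun y => ?_)
  rw [norm_mul]
  exact mul_le_mul_of_nonneg_left (hA i j y) (norm_nonneg _)

/-- The `k`-th component of the kernel `z / |z|³`. -/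
def newtonKer (k : Fin 3) (z : E3) : ℝ := z k / ‖z‖ ^ 3

lemma newtonKer_smul (k : Fin 3) {l : ℝ} (hl : 0 < l) (z : E3) :
    newtonKer k (l • z) = (l ^ 2)⁻¹ * newtonKer k z := by
  simp only [newtonKer, PiLp.smul_apply, smul_eq_mul, norm_smul, Real.norm_eq_abs, abs_of_pos hl]
  rw [mul_pow]
  field_simp

lemma measurable_newtonKer (k : Fin 3) : Measurable (newtonKer k) := by
  have : Measurable fun z : E3 => z k := (EuclideanSpace.proj (𝕜 := ℝ) k).continuous.measurable
  exact this.div (measurable_norm.pow_const 3)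

lemma abs_newtonKer_le (k : Fin 3) (z : E3) : |newtonKer k z| ≤ (‖z‖ ^ 2)⁻¹ := by
  rcases eq_or_ne z 0 with rfl | hz
  · simp [newtonKer]
  have h := norm_pos_iff.2 hz
  rw [newtonKer, abs_div, abs_of_pos (pow_pos h 3), div_le_iff₀ (pow_pos h 3)]
  calc |z k| ≤ ‖z‖ := PiLp.norm_apply_le z k
    _ = (‖z‖ ^ 2)⁻¹ * ‖z‖ ^ 3 := by field_simp

/-- A smooth cutoff equal to `1` on the unit ball and supported in the ball of radius `2`. -/
def unitCutoff : ContDiffBump (0 : E3) := ⟨1, 2, one_pos, one_lt_two⟩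

lemma integrable_unitCutoff_mul_newtonKer (k : Fin 3) :
    Integrable fun z => unitCutoff z * newtonKer k z := by
  have h : IntegrableOn (fun z : E3 => (‖z‖ ^ 2)⁻¹) (Metric.ball 0 2) := by
    rw [integrableOn_fun_norm_addHaar volume (f := fun r => (r ^ 2)⁻¹)]
    refine (integrableOn_congr_fun (g := fun _ => (1 : ℝ)) (fun r hr => ?_) measurableSet_Ioo).2 ?_
    · have : r ≠ 0 := hr.1.ne'
      simp [this]
    · simp
  refine (h.integrable_indicator Metric.isOpen_ball.measurableSet).mono'
    (unitCutoff.continuous.measurable.mul (measurable_newtonKer k)).aestronglyMeasurable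
    (Filter.Eventually.of_forall fun z => ?_)
  by_cases hz : z ∈ Metric.ball (0 : E3) 2
  · rw [indicator_of_mem hz, norm_mul, Real.norm_of_nonneg unitCutoff.nonneg]
    exact (mul_le_of_le_one_left (norm_nonneg _) unitCutoff.le_one).trans (abs_newtonKer_le k z)
  · have : unitCutoff z = 0 := unitCutoff.zero_of_le_dist (by simpa [unitCutoff] using hz)
    simp [indicator_of_notMem hz, this]

lemma abs_integral_near_le (k : Fin 3) {F : E3 → ℝ} {A : ℝ} (hF : ∀ y, |F y| ≤ A) (x : E3) :
    |∫ y, unitCutoff (y - x) * newtonKer k (y - x) * F y| ≤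
      (∫ z, |unitCutoff z * newtonKer k z|) * A := by
  rw [← integral_sub_right_eq_self (fun z => |unitCutoff z * newtonKer k z|) x,
    ← integral_mul_const, ← Real.norm_eq_abs]
  refine norm_integral_le_of_norm_le
    (((integrable_unitCutoff_mul_newtonKer k).abs.comp_sub_right x).mul_const A)
    (Filter.Eventually.of_forall fun y => ?_)
  rw [norm_mul]
  exact mul_le_mul_of_nonneg_left (hF y) (norm_nonneg _)

/-- The Newtonian kernel localized to a dyadic annulus. -/
def annulusKer (k : Fin 3) (z : E3) : ℝ :=
  (unitCutoff ((2 : ℝ)⁻¹ • z) - unitCutoff z) * newtonKer k z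

lemma contDiff_annulusKer (k : Fin 3) : ContDiff ℝ 2 (annulusKer k) := by
  refine contDiff_iff_contDiffAt.2 fun z => ?_
  rcases eq_or_ne z 0 with rfl | hz
  · refine (contDiffAt_const (c := (0 : ℝ))).congr_of_eventuallyEq ?_
    filter_upwards [Metric.ball_mem_nhds (0 : E3) one_pos] with y hy
    have hy' : ‖y‖ < 1 := by simpa using hy
    have h1 : unitCutoff y = 1 := unitCutoff.one_of_mem_closedBall (by
      simpa [unitCutoff] using hy'.le)
    have h2 : unitCutoff ((2 : ℝ)⁻¹ • y) = 1 := unitCutoff.one_of_mem_closedBall (by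
      simp only [unitCutoff, mem_closedBall_zero_iff, norm_smul]
      norm_num
      linarith)
    simp [annulusKer, h1, h2]
  · have h1 : ContDiffAt ℝ 2 (fun z : E3 => z k) z := (contDiff_id.e3_apply k).contDiffAt
    have h2 : ContDiffAt ℝ 2 (fun z : E3 => ‖z‖ ^ 3) z := (contDiffAt_norm ℝ hz).pow 3
    have h3 : ContDiff ℝ 2 fun z : E3 => unitCutoff ((2 : ℝ)⁻¹ • z) - unitCutoff z :=
      (unitCutoff.contDiff.comp (contDiff_const_smul _)).sub unitCutoff.contDiff
    exact h3.contDiffAt.mul (h1.div h2 (pow_ne_zero _ (norm_ne_zero_iff.2 hz)))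

lemma hasCompactSupport_annulusKer (k : Fin 3) : HasCompactSupport (annulusKer k) :=
  ((unitCutoff.hasCompactSupport.comp_smul (inv_ne_zero two_ne_zero)).sub
    unitCutoff.hasCompactSupport).mul_right

lemma cutoff_sub_mul_newtonKer (k : Fin 3) {l : ℝ} (hl : 0 < l) (z : E3) :
    (unitCutoff ((l * 2⁻¹) • z) - unitCutoff (l • z)) * newtonKer k z =
      l ^ 2 * annulusKer k (l • z) := by
  rw [annulusKer, newtonKer_smul k hl, smul_smul, mul_comm l]
  field_simp

lemma abs_integral_newtonKer_le (k : Fin 3) {w u : E3 → E3} (hw : ContDiff ℝ 1 w)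
    (hu : ContDiff ℝ 1 u) (hdw : ∀ x, divg w x = 0) (hdu : ∀ x, divg u x = 0) {D A : ℝ}
    (hD : ∀ i j y, |pd j (fun z => w z i) y| ≤ D) (hA : ∀ i j y, |u y j * w y i| ≤ A)
    (hF : ∀ y, |pressF w u y| ≤ 9 * A) (x : E3)
    (hint : Integrable fun y => newtonKer k (y - x) * pressF w u y) :
    |∫ y, newtonKer k (y - x) * pressF w u y| ≤
      (9 * (∫ z, |unitCutoff z * newtonKer k z|) + 2 * hessMass (annulusKer k)) * A := by
  set B := ∫ z, |unitCutoff z * newtonKer k z|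
  set M := hessMass (annulusKer k)
  have hM : 0 ≤ M := hessMass_nonneg _
  have hA0 : 0 ≤ A := (abs_nonneg _).trans (hA 0 0 0)
  have hcut (l : ℝ) : Continuous fun y : E3 => unitCutoff (l • (y - x)) :=
    unitCutoff.continuous.comp (by fun_prop)
  have hcut1 (l : ℝ) (y : E3) : ‖unitCutoff (l • (y - x))‖ ≤ 1 := by
    rw [Real.norm_of_nonneg unitCutoff.nonneg]; exact unitCutoff.le_one
  have hintl (l : ℝ) : Integrable fun y =>
      unitCutoff (l • (y - x)) * (newtonKer k (y - x) * pressF w u y) :=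
    hint.bdd_mul (hcut l).aestronglyMeasurable (Filter.Eventually.of_forall (hcut1 l))
  have hstep {l : ℝ} (hl : 0 < l) :
      |(∫ y, unitCutoff ((l * 2⁻¹) • (y - x)) * (newtonKer k (y - x) * pressF w u y)) -
        ∫ y, unitCutoff (l • (y - x)) * (newtonKer k (y - x) * pressF w u y)| ≤ l * M * A := by
    have h1 : (∫ y, unitCutoff ((l * 2⁻¹) • (y - x)) * (newtonKer k (y - x) * pressF w u y)) -
        ∫ y, unitCutoff (l • (y - x)) * (newtonKer k (y - x) * pressF w u y) =
        l ^ 2 * ∫ y, annulusKer k (l • (y - x)) * pressF w u y := by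
      rw [← integral_sub (hintl _) (hintl _), ← integral_const_mul]
      congr 1; ext y
      rw [← mul_assoc (l ^ 2), ← cutoff_sub_mul_newtonKer k hl]
      ring
    have hc : HasCompactSupport fun y => annulusKer k (l • (y - x)) :=
      (hasCompactSupport_annulusKer k).comp_homeomorph
        ((Homeomorph.subRight x).trans (Homeomorph.smulOfNeZero l hl.ne'))
    have hd : ContDiff ℝ 2 fun y => annulusKer k (l • (y - x)) :=
      (contDiff_annulusKer k).comp ((contDiff_id.sub contDiff_const).const_smul l)
    have h2 := abs_integral_mul_pressF_le hd hc hw hu hdw hdu hD hA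
    rw [hessMass_comp_smul_sub (contDiff_annulusKer k) hl] at h2
    rw [h1, abs_mul, abs_of_pos (pow_pos hl 2)]
    calc _ ≤ l ^ 2 * (l⁻¹ * M * A) := by gcongr
      _ = l * M * A := by field_simp
  have hpart (n : ℕ) :
      |∫ y, unitCutoff (((2 : ℝ)⁻¹ ^ n) • (y - x)) * (newtonKer k (y - x) * pressF w u y)| ≤
        (9 * B + 2 * (1 - 2⁻¹ ^ n) * M) * A := by
    induction n with
    | zero =>
      have := abs_integral_near_le k hF x
      simp only [pow_zero, one_smul, ← mul_assoc]
      linarith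
    | succ n ih =>
      have h := hstep (l := 2⁻¹ ^ n) (by positivity)
      rw [← pow_succ] at h
      have h' := abs_sub_abs_le_abs_sub
        (∫ y, unitCutoff (((2 : ℝ)⁻¹ ^ (n + 1)) • (y - x)) * (newtonKer k (y - x) * pressF w u y))
        (∫ y, unitCutoff (((2 : ℝ)⁻¹ ^ n) • (y - x)) * (newtonKer k (y - x) * pressF w u y))
      have e : (9 * B + 2 * (1 - 2⁻¹ ^ (n + 1)) * M) * A =
        (9 * B + 2 * (1 - 2⁻¹ ^ n) * M) * A + 2⁻¹ ^ n * M * A := by rw [pow_succ]; ring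
      rw [e]
      linarith
  have hlim : Filter.Tendsto (fun n : ℕ =>
      ∫ y, unitCutoff (((2 : ℝ)⁻¹ ^ n) • (y - x)) * (newtonKer k (y - x) * pressF w u y))
      Filter.atTop (nhds (∫ y, newtonKer k (y - x) * pressF w u y)) := by
    refine tendsto_integral_of_dominated_convergence _ (fun n => (hintl _).aestronglyMeasurable)
      hint.norm (fun n => Filter.Eventually.of_forall fun y => ?_)
      (Filter.Eventually.of_forall fun y => ?_)
    · rw [norm_mul]
      exact mul_le_of_le_one_left (norm_nonneg _) (hcut1 _ y)
    · have h1 : Filter.Tendsto (fun n : ℕ => ((2 : ℝ)⁻¹ ^ n) • (y - x)) Filter.atTop (nhds 0) := by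
        simpa using (tendsto_pow_atTop_nhds_zero_of_lt_one (r := (2 : ℝ)⁻¹) (by norm_num)
          (by norm_num)).smul_const (y - x)
      have h2 := (unitCutoff.continuous.tendsto 0).comp h1
      have h3 : unitCutoff (0 : E3) = 1 :=
        unitCutoff.one_of_mem_closedBall (by simp [unitCutoff])
      rw [h3] at h2
      simpa using h2.mul_const (newtonKer k (y - x) * pressF w u y)
  refine le_of_tendsto hlim.abs (Filter.Eventually.of_forall fun n => (hpart n).trans ?_)
  have : (0 : ℝ) ≤ 2⁻¹ ^ n := by positivity
  gcongr
  nlinarith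

lemma weight_mul_weight_le {ω t : ℝ} (hω : 0 ≤ ω) (ht : 0 ≤ t) (s : ℝ) :
    (1 + |s + t|) ^ (-ω) * (1 + |s - t|) ^ (-ω) ≤ (1 + t) ^ (-ω) := by
  rw [← Real.mul_rpow (by positivity) (by positivity)]
  refine Real.rpow_le_rpow_of_nonpos (by positivity) ?_ (by linarith)
  have h1 := le_abs_self (s + t)
  have h2 := neg_le_abs (s - t)
  nlinarith [mul_nonneg (abs_nonneg (s + t)) (abs_nonneg (s - t))]

/-- **Decay of the pressure gradient for separated Alfvén waves.**
There is a universal constant `C > 0` such that if `z±` are C¹ divergence-free fields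
with `|z±| , |∇z±| ≤ ε(1+|y₃±t|)^{-ω}` (ω > 1, ε > 0, t ≥ 0), then the Newtonian
potential gradient of the pressure satisfies `|(∇p)(x)| ≤ C ε² (1+t)^{-ω}`. -/
theorem pressure_gradient_decay :
    ∃ C > (0 : ℝ), ∀ (ω ε t : ℝ), 1 < ω → 0 < ε → 0 ≤ t →
      ∀ zp zm : E3 → E3,
        ContDiff ℝ 1 zp → ContDiff ℝ 1 zm →
        (∀ x, divg zp x = 0) → (∀ x, divg zm x = 0) →
        (∀ y : E3, ‖zp y‖ ≤ ε * (1 + |y 2 + t|) ^ (-ω)) →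
        (∀ y : E3, ‖zm y‖ ≤ ε * (1 + |y 2 - t|) ^ (-ω)) →
        (∀ y : E3, Real.sqrt (sqDeriv1 zp y) ≤ ε * (1 + |y 2 + t|) ^ (-ω)) →
        (∀ y : E3, Real.sqrt (sqDeriv1 zm y) ≤ ε * (1 + |y 2 - t|) ^ (-ω)) →
        ∀ x : E3, ‖gradP zp zm x‖ ≤ C * ε ^ 2 * (1 + t) ^ (-ω) := by
  set K : Fin 3 → ℝ := fun k =>
    9 * (∫ z, |unitCutoff z * newtonKer k z|) + 2 * hessMass (annulusKer k)
  have hK (k : Fin 3) : 0 ≤ K k := by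
    have h1 : 0 ≤ ∫ z, |unitCutoff z * newtonKer k z| := integral_nonneg fun _ => abs_nonneg _
    have h2 := hessMass_nonneg (annulusKer k)
    positivity
  have hKs : 0 ≤ ∑ k, K k := Finset.sum_nonneg fun k _ => hK k
  refine ⟨1 / (4 * Real.pi) * ∑ k, K k + 1, by positivity, ?_⟩
  intro ω ε t hω hε ht zp zm hzp hzm hdp hdm hp hm hp' hm' x
  set A := ε ^ 2 * (1 + t) ^ (-ω)
  have hA0 : 0 ≤ A := by positivity
  have hprod {a b : ℝ} (y : E3) (ha : |a| ≤ ε * (1 + |y 2 - t|) ^ (-ω))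
      (hb : |b| ≤ ε * (1 + |y 2 + t|) ^ (-ω)) : |a * b| ≤ A := by
    rw [abs_mul]
    calc |a| * |b| ≤ (ε * (1 + |y 2 - t|) ^ (-ω)) * (ε * (1 + |y 2 + t|) ^ (-ω)) := by gcongr
      _ = ε ^ 2 * ((1 + |y 2 + t|) ^ (-ω) * (1 + |y 2 - t|) ^ (-ω)) := by ring
      _ ≤ A := by
        exact mul_le_mul_of_nonneg_left
          (weight_mul_weight_le (zero_le_one.trans hω.le) ht (y 2)) (sq_nonneg ε)
  have hD (i j : Fin 3) (y : E3) : |pd j (fun z => zp z i) y| ≤ ε := by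
    refine ((abs_pd_le hzp j i y).trans (hp' y)).trans (mul_le_of_le_one_right hε.le ?_)
    exact Real.rpow_le_one_of_one_le_of_nonpos (by simp) (by linarith)
  have hA (i j : Fin 3) (y : E3) : |zm y j * zp y i| ≤ A :=
    hprod y ((PiLp.norm_apply_le _ j).trans (hm y)) ((PiLp.norm_apply_le _ i).trans (hp y))
  have hF (y : E3) : |pressF zp zm y| ≤ 9 * A := by
    calc |pressF zp zm y| ≤ ∑ _i : Fin 3, ∑ _j : Fin 3, A :=
        (Finset.abs_sum_le_sum_abs _ _).trans <| Finset.sum_le_sum fun i _ =>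
          (Finset.abs_sum_le_sum_abs _ _).trans <| Finset.sum_le_sum fun j _ =>
            hprod y ((abs_pd_le hzm i j y).trans (hm' y)) ((abs_pd_le hzp j i y).trans (hp' y))
      _ = 9 * A := by simp; ring
  have hcomp (k : Fin 3) (y : E3) : ((pressF zp zm y / ‖x - y‖ ^ 3) • (x - y)) k =
      -(newtonKer k (y - x) * pressF zp zm y) := by
    simp only [newtonKer, PiLp.smul_apply, PiLp.sub_apply, smul_eq_mul, norm_sub_rev x y]
    ring
  have hmain : ‖∫ y, (pressF zp zm y / ‖x - y‖ ^ 3) • (x - y)‖ ≤ (∑ k, K k) * A := by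
    by_cases hint : Integrable fun y => (pressF zp zm y / ‖x - y‖ ^ 3) • (x - y)
    · have hk (k : Fin 3) :
          |(∫ y, (pressF zp zm y / ‖x - y‖ ^ 3) • (x - y)) k| ≤ K k * A := by
        have h1 : ∫ y, ((pressF zp zm y / ‖x - y‖ ^ 3) • (x - y)) k =
            (∫ y, (pressF zp zm y / ‖x - y‖ ^ 3) • (x - y)) k :=
          (EuclideanSpace.proj (𝕜 := ℝ) k).integral_comp_comm hint
        have h2 : Integrable fun y => ((pressF zp zm y / ‖x - y‖ ^ 3) • (x - y)) k :=
          (EuclideanSpace.proj (𝕜 := ℝ) k).integrable_comp hint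
        simp only [hcomp] at h1 h2
        rw [← h1, integral_neg, abs_neg]
        exact abs_integral_newtonKer_le k hzp hzm hdp hdm hD hA hF x (by simpa using h2.neg)
      set v := ∫ y, (pressF zp zm y / ‖x - y‖ ^ 3) • (x - y)
      rw [EuclideanSpace.norm_eq, Finset.sum_mul]
      refine Real.sqrt_le_iff.2 ⟨Finset.sum_nonneg fun k _ => mul_nonneg (hK k) hA0, ?_⟩
      refine (Finset.sum_sq_le_sq_sum_of_nonneg fun k _ => norm_nonneg (v k)).trans ?_
      exact pow_le_pow_left₀ (Finset.sum_nonneg fun k _ => norm_nonneg _)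
        (Finset.sum_le_sum fun k _ => hk k) 2
    · rw [integral_undef hint, norm_zero]
      positivity
  rw [gradP, norm_smul, Real.norm_of_nonneg (by positivity)]
  calc 1 / (4 * Real.pi) * _ ≤ 1 / (4 * Real.pi) * ((∑ k, K k) * A) := by gcongr
    _ ≤ (1 / (4 * Real.pi) * ∑ k, K k + 1) * A := by linarith
    _ = _ := by simp only [A]; ring

end
end
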